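/- arXiv:1810.09547 — 4 statements merged into one kernel-verified Lean document; each statement's English description precedes it below -/
import Mathlib

section
/- Let α be a real number and C₁, C₂ real constants. Then the function φ(η) = C₁·M(−α/2, 1/2, −η²) + C₂·η·M(−α/2 + 1/2, 3/2, −η²) is twice differentiable on ℝ and satisfies Kummer-type ordinary differential equation φ''(η) + 2η·φ'(η) − 2α·φ(η) = 0 for every η ∈ ℝ. -/
/-- Kummer's confluent hypergeometric function
`M(a,b,z) = ∑ (a)_n / (b)_n · zⁿ/n!`, with `(a)_n` the rising factorial. -/
noncomputable def kummerM (a b z : ℝ) : ℝ :=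
  ∑' n : ℕ, ((ascPochhammer ℝ n).eval a / (ascPochhammer ℝ n).eval b) * z ^ n / (n.factorial : ℝ)

/-- The `n`-th term of the series defining `kummerM a b z`. -/
noncomputable def kummerTerm (a b z : ℝ) (n : ℕ) : ℝ :=
  ((ascPochhammer ℝ n).eval a / (ascPochhammer ℝ n).eval b) * z ^ n / (n.factorial : ℝ)

theorem ascPochhammer_eval_succ_left (a : ℝ) (n : ℕ) :
    (ascPochhammer ℝ (n + 1)).eval a = a * (ascPochhammer ℝ n).eval (a + 1) := by
  simp [ascPochhammer_succ_left]

theorem ascPochhammer_eval_ne_zero {b : ℝ} (hb : ∀ n : ℕ, b + n ≠ 0) (n : ℕ) :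
    (ascPochhammer ℝ n).eval b ≠ 0 := by
  induction n with
  | zero => simp
  | succ n ih =>
    rw [ascPochhammer_succ_eval]
    exact mul_ne_zero ih (hb n)

theorem add_one_add_natCast_ne_zero {b : ℝ} (hb : ∀ n : ℕ, b + n ≠ 0) (n : ℕ) :
    b + 1 + n ≠ 0 := by
  have h := hb (n + 1)
  push_cast at h
  convert h using 1
  ring

theorem kummerTerm_succ {b : ℝ} (hb : ∀ n : ℕ, b + n ≠ 0) (a z : ℝ) (n : ℕ) :
    kummerTerm a b z (n + 1) = (a + n) / (b + n) * (z / (n + 1)) * kummerTerm a b z n := by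
  have h₁ := ascPochhammer_eval_ne_zero hb n
  have h₂ := hb n
  have h₃ : (n.factorial : ℝ) ≠ 0 := by positivity
  simp only [kummerTerm, ascPochhammer_succ_eval, Nat.factorial_succ]
  push_cast
  field_simp
  ring

theorem natCast_succ_mul_kummerTerm_succ (a b z : ℝ) (n : ℕ) :
    ((n + 1 : ℕ) : ℝ) * kummerTerm a b z (n + 1) =
      z * (a / b) * kummerTerm (a + 1) (b + 1) z n := by
  have h₃ : (n.factorial : ℝ) ≠ 0 := by positivity
  simp only [kummerTerm, ascPochhammer_eval_succ_left, Nat.factorial_succ]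
  push_cast
  field_simp
  ring

theorem kummerTerm_add_one {b : ℝ} (hb : ∀ n : ℕ, b + n ≠ 0) (a z : ℝ) (n : ℕ) :
    (n + b) * (a / b * kummerTerm (a + 1) (b + 1) z n) = (n + a) * kummerTerm a b z n := by
  have h₀ : b ≠ 0 := by simpa using hb 0
  have h₁ := ascPochhammer_eval_ne_zero hb n
  have h₂ := ascPochhammer_eval_ne_zero (add_one_add_natCast_ne_zero hb) n
  have hA : a * (ascPochhammer ℝ n).eval (a + 1) = (ascPochhammer ℝ n).eval a * (a + n) := by
    rw [← ascPochhammer_eval_succ_left, ascPochhammer_succ_eval]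
  have hB : b * (ascPochhammer ℝ n).eval (b + 1) = (ascPochhammer ℝ n).eval b * (b + n) := by
    rw [← ascPochhammer_eval_succ_left, ascPochhammer_succ_eval]
  have key : (n + b) * (a / b * ((ascPochhammer ℝ n).eval (a + 1) /
      (ascPochhammer ℝ n).eval (b + 1))) =
      (n + a) * ((ascPochhammer ℝ n).eval a / (ascPochhammer ℝ n).eval b) := by
    field_simp
    linear_combination (n + b) * (ascPochhammer ℝ n).eval b * hA
      - (n + a) * (ascPochhammer ℝ n).eval a * hB
  simp only [kummerTerm]
  linear_combination z ^ n / (n.factorial : ℝ) * key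

theorem summable_kummerTerm {b : ℝ} (hb : ∀ n : ℕ, b + n ≠ 0) (a z : ℝ) :
    Summable (kummerTerm a b z) := by
  have hlim : Filter.Tendsto (fun n : ℕ => (a + n) / (b + n) * (z / ((n : ℝ) + 1)))
      Filter.atTop (nhds 0) := by
    have h₁ : Filter.Tendsto (fun n : ℕ => (a + (1 : ℝ) * n) / (b + (1 : ℝ) * n))
        Filter.atTop (nhds (1 / 1)) := tendsto_add_mul_div_add_mul_atTop_nhds a b 1 one_ne_zero
    have h₂ : Filter.Tendsto (fun n : ℕ => z / ((n : ℝ) + 1)) Filter.atTop (nhds 0) :=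
      tendsto_const_nhds.div_atTop
        (Filter.tendsto_atTop_add_const_right _ _ tendsto_natCast_atTop_atTop)
    simpa using h₁.mul h₂
  refine summable_of_ratio_norm_eventually_le (r := 1 / 2) (by norm_num) ?_
  filter_upwards [hlim.norm.eventually_le_const (u := 1 / 2) (by norm_num)] with n hn
  rw [kummerTerm_succ hb, norm_mul]
  gcongr

theorem hasSum_kummerTerm {b : ℝ} (hb : ∀ n : ℕ, b + n ≠ 0) (a z : ℝ) :
    HasSum (kummerTerm a b z) (kummerM a b z) :=
  (summable_kummerTerm hb a z).hasSum

theorem hasSum_natCast_mul_kummerTerm {b : ℝ} (hb : ∀ n : ℕ, b + n ≠ 0) (a z : ℝ) :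
    HasSum (fun n : ℕ => (n : ℝ) * kummerTerm a b z n)
      (z * (a / b) * kummerM (a + 1) (b + 1) z) := by
  rw [← hasSum_nat_add_iff' 1]
  simp only [natCast_succ_mul_kummerTerm_succ]
  simpa using (hasSum_kummerTerm (add_one_add_natCast_ne_zero hb) (a + 1) z).mul_left (z * (a / b))

/-- Kummer's equation `z M'' + (b - z) M' = a M`, with the derivatives of `M` written
as contiguous functions. -/
theorem kummerM_contiguous {b : ℝ} (hb : ∀ n : ℕ, b + n ≠ 0) (a z : ℝ) :
    z * (a / b * ((a + 1) / (b + 1) * kummerM (a + 1 + 1) (b + 1 + 1) z)) +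
      (b - z) * (a / b * kummerM (a + 1) (b + 1) z) = a * kummerM a b z := by
  have hb' := add_one_add_natCast_ne_zero hb
  have h₁ := ((hasSum_natCast_mul_kummerTerm hb' (a + 1) z).mul_left (a / b)).add
    ((hasSum_kummerTerm hb' (a + 1) z).mul_left (b * (a / b)))
  have h₂ := (hasSum_natCast_mul_kummerTerm hb a z).add ((hasSum_kummerTerm hb a z).mul_left a)
  have h := h₁.unique (h₂.congr_fun fun n => by linear_combination kummerTerm_add_one hb a z n)
  linear_combination h

theorem hasDerivAt_kummerM {b : ℝ} (hb : ∀ n : ℕ, b + n ≠ 0) (a z : ℝ) :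
    HasDerivAt (kummerM a b) (a / b * kummerM (a + 1) (b + 1) z) z := by
  have hb' := add_one_add_natCast_ne_zero hb
  set c : ℕ → ℝ := fun n => kummerTerm a b 1 n with hc
  have hterm (w : ℝ) (n : ℕ) : kummerTerm a b w n = c n * w ^ n := by
    simp [hc, kummerTerm]; ring
  have hshift (w : ℝ) (n : ℕ) :
      c (n + 1) * (((n + 1 : ℕ) : ℝ) * w ^ n) = a / b * kummerTerm (a + 1) (b + 1) w n := by
    have h := natCast_succ_mul_kummerTerm_succ a b 1 n
    have h' : kummerTerm (a + 1) (b + 1) w n = kummerTerm (a + 1) (b + 1) 1 n * w ^ n := by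
      simp [kummerTerm]; ring
    rw [h']
    linear_combination w ^ n * h
  have hsum (w : ℝ) : HasSum (fun n : ℕ => c n * ((n : ℝ) * w ^ (n - 1)))
      (a / b * kummerM (a + 1) (b + 1) w) := by
    rw [← hasSum_nat_add_iff' 1]
    simp only [Nat.add_sub_cancel, hshift]
    simpa using (hasSum_kummerTerm hb' (a + 1) w).mul_left (a / b)
  have hz : z ∈ Metric.ball (0 : ℝ) (|z| + 1) := by simp
  have h := hasDerivAt_tsum_of_isPreconnected (hsum (|z| + 1)).summable.norm Metric.isOpen_ball
    (convex_ball (0 : ℝ) (|z| + 1)).isPreconnected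
    (fun n w _ => (hasDerivAt_pow n w).const_mul (c n))
    (fun n w hw => ?_) hz ((summable_kummerTerm hb a z).congr (hterm z)) hz
  · rw [(hsum z).tsum_eq] at h
    refine h.congr_of_eventuallyEq (.of_forall fun w => ?_)
    exact tsum_congr (hterm w)
  · have hw' : |w| ≤ |(|z| + 1)| := by
      rw [abs_of_nonneg (by positivity : 0 ≤ |z| + 1)]
      simpa using (mem_ball_zero_iff.mp hw).le
    simp only [norm_mul, norm_pow, Real.norm_eq_abs]
    gcongr

theorem hasDerivAt_kummerM_neg_sq {b : ℝ} (hb : ∀ n : ℕ, b + n ≠ 0) (a η : ℝ) :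
    HasDerivAt (fun η => kummerM a b (-η ^ 2))
      (a / b * kummerM (a + 1) (b + 1) (-η ^ 2) * (-(2 * η))) η := by
  have h : HasDerivAt (fun η : ℝ => -η ^ 2) (-(2 * η)) η := by
    simpa using (hasDerivAt_pow 2 η).fun_neg
  exact (hasDerivAt_kummerM hb a (-η ^ 2)).comp η h

/-- The function `φ(η) = C₁·M(−α/2,1/2,−η²) + C₂·η·M(−α/2+1/2,3/2,−η²)` is twice
differentiable on `ℝ` and satisfies `φ'' + 2ηφ' − 2αφ = 0` everywhere. -/
theorem stmt0 (α C₁ C₂ : ℝ) (φ : ℝ → ℝ)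
    (hφ : φ = fun η => C₁ * kummerM (-α/2) (1/2) (-η^2) +
      C₂ * η * kummerM (-α/2 + 1/2) (3/2) (-η^2)) :
    Differentiable ℝ φ ∧ Differentiable ℝ (deriv φ) ∧
    ∀ η : ℝ, deriv (deriv φ) η + 2 * η * deriv φ η - 2 * α * φ η = 0 := by
  have hb₁ (n : ℕ) : (1 / 2 : ℝ) + n ≠ 0 := by positivity
  have hb₂ (n : ℕ) : (3 / 2 : ℝ) + n ≠ 0 := by positivity
  have hb₁' := add_one_add_natCast_ne_zero hb₁
  have hb₂' := add_one_add_natCast_ne_zero hb₂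
  have hd (η : ℝ) := ((hasDerivAt_kummerM_neg_sq hb₁ (-α/2) η).const_mul C₁).fun_add
    (((hasDerivAt_id' η).const_mul C₂).fun_mul (hasDerivAt_kummerM_neg_sq hb₂ (-α/2 + 1/2) η))
  have hφd (η : ℝ) : HasDerivAt φ _ η := hφ ▸ hd η
  have hlin (η : ℝ) : HasDerivAt (fun η : ℝ => -(2 * η)) (-(2 * 1)) η :=
    ((hasDerivAt_id' η).const_mul 2).neg
  have hφdd (η : ℝ) := ((((hasDerivAt_kummerM_neg_sq hb₁' (-α/2 + 1) η).const_mul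
    (-α/2 / (1/2))).fun_mul (hlin η)).const_mul C₁).fun_add
    (((hasDerivAt_kummerM_neg_sq hb₂ (-α/2 + 1/2) η).const_mul (C₂ * 1)).fun_add
    (((hasDerivAt_id' η).const_mul C₂).fun_mul
      (((hasDerivAt_kummerM_neg_sq hb₂' (-α/2 + 1/2 + 1) η).const_mul
        ((-α/2 + 1/2) / (3/2))).fun_mul (hlin η))))
  have hderiv := funext fun η => (hφd η).deriv
  have hφdd' (η : ℝ) : HasDerivAt (deriv φ) _ η := hderiv ▸ hφdd η
  refine ⟨fun η => (hφd η).differentiableAt, fun η => (hφdd' η).differentiableAt, fun η => ?_⟩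
  rw [(hφdd' η).deriv, (hφd η).deriv, hφ]
  have h₁ := kummerM_contiguous hb₁ (-α/2) (-η ^ 2)
  have h₂ := kummerM_contiguous hb₂ (-α/2 + 1/2) (-η ^ 2)
  linear_combination -4 * C₁ * h₁ - 4 * C₂ * η * h₂
end

section
/- For every real α and every real z, the following product identity for Kummer functions holds: e^{−z²} = −2α·z²·M(−α/2 + 1/2, 3/2, −z²)·M(−α/2 + 1, 3/2, −z²) + M(−α/2, 1/2, −z²)·M(−α/2 + 1/2, 1/2, −z²). -/
/-- Coefficients of the power series defining `kummerM a b`. -/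
noncomputable def kummerCoeff (a b : ℝ) (n : ℕ) : ℝ :=
  (ascPochhammer ℝ n).eval a / (ascPochhammer ℝ n).eval b / (n.factorial : ℝ)

/-- The coefficient sequence `c` is bounded by that of an exponential `M * exp (K * x)`. -/
def HasExpBound (c : ℕ → ℝ) : Prop :=
  ∃ M K : ℝ, 0 ≤ K ∧ ∀ n, |c n| ≤ M * (K ^ n / (n.factorial : ℝ))

lemma HasExpBound.summable {c : ℕ → ℝ} (hc : HasExpBound c) (x : ℝ) :
    Summable fun n => c n * x ^ n := by
  obtain ⟨M, K, -, h⟩ := hc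
  refine Summable.of_norm_bounded
    ((Real.summable_pow_div_factorial (K * |x|)).mul_left M) fun n => ?_
  rw [Real.norm_eq_abs, abs_mul, abs_pow, mul_pow]
  calc |c n| * |x| ^ n ≤ M * (K ^ n / (n.factorial : ℝ)) * |x| ^ n := by gcongr; exact h n
    _ = _ := by ring

/-- The coefficients of the derivative of a series satisfy an exponential bound too. -/
lemma HasExpBound.derivative {c : ℕ → ℝ} (hc : HasExpBound c) :
    HasExpBound fun n => (n + 1 : ℝ) * c (n + 1) := by
  obtain ⟨M, K, hK, h⟩ := hc
  refine ⟨M * K, K, hK, fun n => ?_⟩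
  have hn : (0 : ℝ) < n + 1 := by positivity
  rw [abs_mul, abs_of_pos hn]
  calc (n + 1 : ℝ) * |c (n + 1)|
      ≤ (n + 1) * (M * (K ^ (n + 1) / ((n + 1).factorial : ℝ))) := by gcongr; exact h _
    _ = _ := by
      rw [Nat.factorial_succ]; push_cast
      have : (n.factorial : ℝ) ≠ 0 := by positivity
      field_simp
      ring

lemma HasExpBound.abs {c : ℕ → ℝ} (hc : HasExpBound c) : HasExpBound fun n => |c n| := by
  obtain ⟨M, K, hK, h⟩ := hc
  exact ⟨M, K, hK, fun n => by rw [abs_abs]; exact h n⟩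

lemma HasExpBound.tsum_eq_zero_add {c : ℕ → ℝ} (hc : HasExpBound c) (x : ℝ) :
    ∑' n, c n * x ^ n = c 0 + ∑' n, c (n + 1) * x ^ (n + 1) := by
  simpa using (hc.summable x).tsum_eq_zero_add

lemma HasExpBound.hasDerivAt {c : ℕ → ℝ} (hc : HasExpBound c) (x : ℝ) :
    HasDerivAt (fun y => ∑' n, c n * y ^ n) (∑' n : ℕ, ((n + 1 : ℝ) * c (n + 1)) * x ^ n) x := by
  have hfun : (fun y => ∑' n, c n * y ^ n) =
      fun y => c 0 + ∑' n, c (n + 1) * y ^ (n + 1) := funext hc.tsum_eq_zero_add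
  rw [hfun]
  refine HasDerivAt.const_add _ ?_
  refine hasDerivAt_tsum_of_isPreconnected (t := Metric.ball (0 : ℝ) (|x| + 1)) (y₀ := x)
    (u := fun n : ℕ => |(n + 1 : ℝ) * c (n + 1)| * (|x| + 1) ^ n)
    (g := fun n y => c (n + 1) * y ^ (n + 1))
    (g' := fun n y => ((n + 1 : ℝ) * c (n + 1)) * y ^ n)
    (hc.derivative.abs.summable _) Metric.isOpen_ball
    (convex_ball _ _).isPreconnected ?_ ?_ ?_ ?_ ?_
  · intro n y _
    refine ((hasDerivAt_pow (n + 1) y).const_mul (c (n + 1))).congr_deriv ?_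
    push_cast
    ring
  · intro n y hy
    rw [mem_ball_zero_iff, Real.norm_eq_abs] at hy
    rw [Real.norm_eq_abs, abs_mul, abs_pow]
    gcongr
  · simp
  · exact (summable_nat_add_iff 1).2 (hc.summable x)
  · simp

lemma kummerM_eq_tsum (a b x : ℝ) : kummerM a b x = ∑' n, kummerCoeff a b n * x ^ n := by
  unfold kummerM kummerCoeff
  exact tsum_congr fun n => by ring

@[simp]
lemma kummerCoeff_zero (a b : ℝ) : kummerCoeff a b 0 = 1 := by simp [kummerCoeff]

lemma kummerCoeff_succ (a b : ℝ) (n : ℕ) :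
    kummerCoeff a b (n + 1) = kummerCoeff a b n * ((a + n) / ((b + n) * (n + 1))) := by
  simp only [kummerCoeff, ascPochhammer_succ_eval, Nat.factorial_succ]
  push_cast
  simp only [div_eq_mul_inv, mul_inv]
  ring

lemma hasExpBound_kummerCoeff (a : ℝ) {b : ℝ} (hb : 1 / 2 ≤ b) :
    HasExpBound (kummerCoeff a b) := by
  refine ⟨1, 2 * |a| + 1, by positivity, fun n => ?_⟩
  rw [one_mul]
  induction n with
  | zero => simp
  | succ n ih =>
    have hbn : 0 < b + n := by positivity
    have hratio : |(a + n) / ((b + n) * (n + 1))| ≤ (2 * |a| + 1) / (n + 1) := by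
      rw [abs_div, abs_of_pos (by positivity : 0 < (b + n) * ((n : ℝ) + 1)), ← div_div]
      gcongr
      rw [div_le_iff₀ hbn]
      have h := abs_add_le a n
      rw [Nat.abs_cast] at h
      have hn : (0 : ℝ) ≤ n := by positivity
      nlinarith [abs_nonneg a, mul_nonneg (abs_nonneg a) hn,
        mul_nonneg (abs_nonneg a) (sub_nonneg.2 hb)]
    rw [kummerCoeff_succ, abs_mul]
    calc _ ≤ ((2 * |a| + 1) ^ n / (n.factorial : ℝ)) * ((2 * |a| + 1) / (n + 1)) := by gcongr
      _ = _ := by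
        rw [Nat.factorial_succ]; push_cast
        have : (n.factorial : ℝ) ≠ 0 := by positivity
        field_simp
        ring

lemma kummerCoeff_one_half_eq (a : ℝ) (n : ℕ) :
    kummerCoeff a (1 / 2) n = (2 * n + 1) * kummerCoeff a (3 / 2) n := by
  induction n with
  | zero => simp
  | succ n ih =>
    rw [kummerCoeff_succ, ih, kummerCoeff_succ]
    push_cast
    have h₁ : (1 / 2 + n : ℝ) ≠ 0 := by positivity
    have h₂ : (3 / 2 + n : ℝ) ≠ 0 := by positivity
    field_simp
    ring

lemma succ_mul_kummerCoeff_succ (a : ℝ) (n : ℕ) :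
    (n + 1 : ℝ) * kummerCoeff a (1 / 2) (n + 1) = 2 * a * kummerCoeff (a + 1) (3 / 2) n := by
  induction n with
  | zero => rw [kummerCoeff_succ]; simp; ring
  | succ n ih =>
    rw [kummerCoeff_succ a, kummerCoeff_succ (a + 1)]
    have hn : (n + 1 : ℝ) ≠ 0 := by positivity
    have h₁ : kummerCoeff a (1 / 2) (n + 1) =
        2 * a * kummerCoeff (a + 1) (3 / 2) n / (n + 1) := by
      rw [← ih]; field_simp
    rw [h₁]
    push_cast
    have h₂ : (1 / 2 + (n + 1) : ℝ) ≠ 0 := by positivity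
    have h₃ : (3 / 2 + n : ℝ) ≠ 0 := by positivity
    field_simp
    ring

lemma hasDerivAt_kummerM_one_half (a x : ℝ) :
    HasDerivAt (kummerM a (1 / 2)) (2 * a * kummerM (a + 1) (3 / 2) x) x := by
  convert (hasExpBound_kummerCoeff a le_rfl).hasDerivAt x using 1
  · exact funext fun y => kummerM_eq_tsum _ _ y
  · simp only [succ_mul_kummerCoeff_succ, mul_assoc, tsum_mul_left, kummerM_eq_tsum]

lemma hasDerivAt_kummerM_one_half' (a x : ℝ) :
    HasDerivAt (kummerM (a + 1 / 2) (1 / 2))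
      (kummerM (a + 1 / 2) (1 / 2) x + 2 * a * kummerM (a + 1 / 2) (3 / 2) x) x := by
  have hB := hasExpBound_kummerCoeff (a + 1 / 2) (b := 1 / 2) le_rfl
  have hC := hasExpBound_kummerCoeff (a + 1 / 2) (b := 3 / 2) (by norm_num)
  convert hB.hasDerivAt x using 1
  · exact funext fun y => kummerM_eq_tsum _ _ y
  · rw [kummerM_eq_tsum, kummerM_eq_tsum, ← tsum_mul_left,
      ← (hB.summable x).tsum_add ((hC.summable x).mul_left _)]
    refine tsum_congr fun n => ?_
    rw [kummerCoeff_succ, kummerCoeff_one_half_eq]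
    have h₁ : (1 / 2 + n : ℝ) ≠ 0 := by positivity
    field_simp
    ring

lemma exists_hasDerivAt_kummerM_three_halves (a x : ℝ) :
    ∃ C', HasDerivAt (kummerM a (3 / 2)) C' x ∧
      2 * (x * C') = kummerM a (1 / 2) x - kummerM a (3 / 2) x := by
  have hB := hasExpBound_kummerCoeff a (b := 1 / 2) le_rfl
  have hC := hasExpBound_kummerCoeff a (b := 3 / 2) (by norm_num)
  have hderiv := hC.hasDerivAt x
  simp only [← kummerM_eq_tsum] at hderiv
  refine ⟨_, hderiv, ?_⟩
  rw [kummerM_eq_tsum, kummerM_eq_tsum, hB.tsum_eq_zero_add, hC.tsum_eq_zero_add,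
    kummerCoeff_zero, kummerCoeff_zero, add_sub_add_left_eq_sub,
    ← ((summable_nat_add_iff 1).2 (hB.summable x)).tsum_sub
      ((summable_nat_add_iff 1).2 (hC.summable x)), ← tsum_mul_left, ← tsum_mul_left]
  refine tsum_congr fun n => ?_
  rw [kummerCoeff_one_half_eq]
  push_cast
  ring

lemma exists_hasDerivAt_kummerM_three_halves' (a x : ℝ) :
    ∃ D', HasDerivAt (kummerM (a + 1) (3 / 2)) D' x ∧
      2 * (x * D') = 2 * (x * kummerM (a + 1) (3 / 2) x) +
        (kummerM a (1 / 2) x - kummerM (a + 1) (3 / 2) x) := by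
  have hA := hasExpBound_kummerCoeff a (b := 1 / 2) le_rfl
  have hD := hasExpBound_kummerCoeff (a + 1) (b := 3 / 2) (by norm_num)
  have hderiv := hD.hasDerivAt x
  simp only [← kummerM_eq_tsum] at hderiv
  refine ⟨_, hderiv, ?_⟩
  have hsub : kummerM a (1 / 2) x - kummerM (a + 1) (3 / 2) x =
      ∑' n, (kummerCoeff a (1 / 2) (n + 1) * x ^ (n + 1) -
        kummerCoeff (a + 1) (3 / 2) (n + 1) * x ^ (n + 1)) := by
    rw [kummerM_eq_tsum, kummerM_eq_tsum, hA.tsum_eq_zero_add, hD.tsum_eq_zero_add,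
      kummerCoeff_zero, kummerCoeff_zero, add_sub_add_left_eq_sub,
      ← ((summable_nat_add_iff 1).2 (hA.summable x)).tsum_sub
        ((summable_nat_add_iff 1).2 (hD.summable x))]
  rw [hsub, kummerM_eq_tsum, ← tsum_mul_left, ← tsum_mul_left, ← tsum_mul_left, ← tsum_mul_left,
    ← (((hD.summable x).mul_left x).mul_left 2).tsum_add
      (((summable_nat_add_iff 1).2 (hA.summable x)).sub
        ((summable_nat_add_iff 1).2 (hD.summable x)))]
  refine tsum_congr fun n => ?_
  have hn : (n + 1 : ℝ) ≠ 0 := by positivity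
  have h₁ : kummerCoeff a (1 / 2) (n + 1) =
      2 * a * kummerCoeff (a + 1) (3 / 2) n / (n + 1) := by
    rw [← succ_mul_kummerCoeff_succ]; field_simp
  rw [h₁, kummerCoeff_succ]
  have h₂ : (3 / 2 + n : ℝ) ≠ 0 := by positivity
  field_simp
  ring

lemma kummerM_zero_right (a b : ℝ) : kummerM a b 0 = 1 := by
  rw [kummerM_eq_tsum, tsum_eq_single 0 fun n hn => by simp [hn]]
  simp

/-- The Wronskian of the two standard solutions of Kummer's equation with `b = 1 / 2`. -/
lemma kummerM_wronskian_eq_exp (a x : ℝ) :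
    kummerM a (1 / 2) x * kummerM (a + 1 / 2) (1 / 2) x -
      4 * a * (x * (kummerM (a + 1 / 2) (3 / 2) x * kummerM (a + 1) (3 / 2) x)) = Real.exp x := by
  set W : ℝ → ℝ := fun x => kummerM a (1 / 2) x * kummerM (a + 1 / 2) (1 / 2) x -
    4 * a * (x * (kummerM (a + 1 / 2) (3 / 2) x * kummerM (a + 1) (3 / 2) x)) with hW
  have hWderiv (y : ℝ) : HasDerivAt W (W y) y := by
    obtain ⟨C', hC, hC'⟩ := exists_hasDerivAt_kummerM_three_halves (a + 1 / 2) y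
    obtain ⟨D', hD, hD'⟩ := exists_hasDerivAt_kummerM_three_halves' a y
    refine (((hasDerivAt_kummerM_one_half a y).mul (hasDerivAt_kummerM_one_half' a y)).sub
      (((hasDerivAt_id y).mul (hC.mul hD)).const_mul (4 * a))).congr_deriv ?_
    simp only [hW, id_eq, Pi.mul_apply]
    linear_combination -2 * a * kummerM (a + 1) (3 / 2) y * hC' -
      2 * a * kummerM (a + 1 / 2) (3 / 2) y * hD'
  have hconst (y : ℝ) : HasDerivAt (fun t => W t * Real.exp (-t)) 0 y := by
    refine ((hWderiv y).mul (hasDerivAt_neg y).exp).congr_deriv ?_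
    ring
  have h := is_const_of_deriv_eq_zero (fun y => (hconst y).differentiableAt)
    (fun y => (hconst y).deriv) x 0
  have hW0 : W 0 = 1 := by simp [hW, kummerM_zero_right]
  simp only [hW0, neg_zero, Real.exp_zero, mul_one, Real.exp_neg] at h
  change W x = Real.exp x
  have hx := Real.exp_ne_zero x
  field_simp at h
  exact h

/-- The product identity
`e^{−z²} = −2αz²·M(−α/2+1/2,3/2,−z²)·M(−α/2+1,3/2,−z²) + M(−α/2,1/2,−z²)·M(−α/2+1/2,1/2,−z²)`. -/
theorem stmt3 (α z : ℝ) :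
    Real.exp (-z^2) =
      -2 * α * z^2 * kummerM (-α/2 + 1/2) (3/2) (-z^2) * kummerM (-α/2 + 1) (3/2) (-z^2) +
      kummerM (-α/2) (1/2) (-z^2) * kummerM (-α/2 + 1/2) (1/2) (-z^2) := by
  rw [← kummerM_wronskian_eq_exp (-α / 2)]
  ring
end

section
/- (Uniqueness of the Dirichlet root.) Let β and δ be real constants with β ≥ max(δ, −1−δ), set α = β − δ, and let k, a, γ, u₀ > 0. Define f(z) = 1/(z·M(α/2 + 1, 3/2, z²)) for z > 0. Then f is strictly decreasing on (0,∞), f(z) → +∞ as z → 0⁺, f(z) → 0 as z → +∞, and the equation (k·u₀/(γ·2^{β+1}·a^{β+δ+2}))·f(z) = z^{β+δ+1} has exactly one solution z = ξ_D with z > 0. -/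
theorem ascPochhammer_eval_div_le_max_pow {a b : ℝ} (ha : 0 < a) (hb : 0 < b) (n : ℕ) :
    (ascPochhammer ℝ n).eval a / (ascPochhammer ℝ n).eval b ≤ max 1 (a / b) ^ n := by
  induction n with
  | zero => simp
  | succ n ih =>
    have h0 := ascPochhammer_pos n a ha
    have h1 := ascPochhammer_pos n b hb
    have h2 : (a + n) / (b + n) ≤ max 1 (a / b) := by
      rw [div_le_iff₀ (by positivity)]
      have h3 : a ≤ max 1 (a / b) * b := (div_le_iff₀ hb).1 (le_max_right _ _)
      have h4 : (n : ℝ) ≤ max 1 (a / b) * n :=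
        le_mul_of_one_le_left n.cast_nonneg (le_max_left _ _)
      linarith
    rw [ascPochhammer_succ_eval, ascPochhammer_succ_eval, mul_div_mul_comm, pow_succ]
    gcongr

theorem kummerM_term_nonneg {a b x : ℝ} (ha : 0 < a) (hb : 0 < b) (hx : 0 ≤ x) (n : ℕ) :
    0 ≤ ((ascPochhammer ℝ n).eval a / (ascPochhammer ℝ n).eval b) * x ^ n / (n.factorial : ℝ) := by
  have h0 := ascPochhammer_pos n a ha
  have h1 := ascPochhammer_pos n b hb
  positivity

theorem kummerM_term_mono {a b x y : ℝ} (ha : 0 < a) (hb : 0 < b) (hx : 0 ≤ x) (hxy : x ≤ y)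
    (n : ℕ) :
    ((ascPochhammer ℝ n).eval a / (ascPochhammer ℝ n).eval b) * x ^ n / (n.factorial : ℝ) ≤
      ((ascPochhammer ℝ n).eval a / (ascPochhammer ℝ n).eval b) * y ^ n / (n.factorial : ℝ) := by
  have h0 := ascPochhammer_pos n a ha
  have h1 := ascPochhammer_pos n b hb
  gcongr

theorem summable_kummerM_term {a b x : ℝ} (ha : 0 < a) (hb : 0 < b) (hx : 0 ≤ x) :
    Summable fun n : ℕ =>
      ((ascPochhammer ℝ n).eval a / (ascPochhammer ℝ n).eval b) * x ^ n / (n.factorial : ℝ) := by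
  refine Summable.of_nonneg_of_le (kummerM_term_nonneg ha hb hx) (fun n => ?_)
    (Real.summable_pow_div_factorial (max 1 (a / b) * x))
  rw [mul_pow]
  gcongr
  exact ascPochhammer_eval_div_le_max_pow ha hb n

theorem one_le_kummerM {a b x : ℝ} (ha : 0 < a) (hb : 0 < b) (hx : 0 ≤ x) :
    1 ≤ kummerM a b x := by
  simpa [kummerM] using (summable_kummerM_term ha hb hx).le_tsum 0
    fun n _ => kummerM_term_nonneg ha hb hx n

theorem monotoneOn_kummerM {a b : ℝ} (ha : 0 < a) (hb : 0 < b) :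
    MonotoneOn (kummerM a b) (Set.Ici 0) := fun _ hx _ hy hxy =>
  (summable_kummerM_term ha hb hx).tsum_le_tsum (kummerM_term_mono ha hb hx hxy)
    (summable_kummerM_term ha hb hy)

theorem continuousOn_kummerM {a b : ℝ} (ha : 0 < a) (hb : 0 < b) :
    ContinuousOn (kummerM a b) (Set.Ici 0) := by
  intro x hx
  have hR : (0 : ℝ) ≤ x + 1 := add_nonneg hx zero_le_one
  have h : ContinuousOn (kummerM a b) (Set.Icc 0 (x + 1)) := by
    refine continuousOn_tsum (fun n => by fun_prop) (summable_kummerM_term ha hb hR)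
      fun n y hy => ?_
    rw [Real.norm_of_nonneg (kummerM_term_nonneg ha hb hy.1 n)]
    exact kummerM_term_mono ha hb hy.1 hy.2 n
  refine (h x ⟨hx, by linarith⟩).mono_of_mem_nhdsWithin ?_
  rw [← Set.Ici_inter_Iic]
  exact Filter.inter_mem self_mem_nhdsWithin
    (mem_nhdsWithin_of_mem_nhds (Iic_mem_nhds (by linarith)))

theorem continuous_mul_kummerM_sq {a b : ℝ} (ha : 0 < a) (hb : 0 < b) :
    Continuous fun z : ℝ => z * kummerM a b (z ^ 2) :=
  continuous_id.mul
    ((continuousOn_kummerM ha hb).comp_continuous (by fun_prop) fun z => sq_nonneg z)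

theorem le_mul_kummerM_sq {a b z : ℝ} (ha : 0 < a) (hb : 0 < b) (hz : 0 ≤ z) :
    z ≤ z * kummerM a b (z ^ 2) :=
  le_mul_of_one_le_right hz (one_le_kummerM ha hb (sq_nonneg z))

theorem strictMonoOn_mul_kummerM_sq {a b : ℝ} (ha : 0 < a) (hb : 0 < b) :
    StrictMonoOn (fun z : ℝ => z * kummerM a b (z ^ 2)) (Set.Ici 0) := by
  intro x hx y hy hxy
  have hx : 0 ≤ x := hx
  have h : kummerM a b (x ^ 2) ≤ kummerM a b (y ^ 2) :=
    monotoneOn_kummerM ha hb (sq_nonneg x) (sq_nonneg y) (by gcongr)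
  have h1 := one_le_kummerM ha hb (sq_nonneg y)
  exact mul_lt_mul_of_lt_of_le_of_nonneg_of_pos hxy h hx (by linarith)

/-- If `G` is continuous, strictly increasing on `[0, ∞)`, vanishes at `0` and dominates the
identity, then `z ^ p * G z` takes each positive value exactly once on `(0, ∞)`. -/
theorem existsUnique_rpow_mul_eq {G : ℝ → ℝ} (hG : Continuous G)
    (hmono : StrictMonoOn G (Set.Ici 0)) (hG0 : G 0 = 0) (hle : ∀ z, 0 ≤ z → z ≤ G z)
    {p C : ℝ} (hp : 0 ≤ p) (hC : 0 < C) : ∃! z : ℝ, 0 < z ∧ z ^ p * G z = C := by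
  have hH : StrictMonoOn (fun z : ℝ => z ^ p * G z) (Set.Ioi 0) := by
    intro x hx y hy hxy
    have hx : 0 < x := hx
    have hy : 0 < y := hy
    have h1 : x ^ p ≤ y ^ p := Real.rpow_le_rpow hx.le hxy.le hp
    have h2 : G x < G y := hmono hx.le hy.le hxy
    exact mul_lt_mul' h1 h2 (hx.le.trans (hle x hx.le)) (Real.rpow_pos_of_pos hy p)
  have hcont : Continuous fun z : ℝ => z ^ p * G z :=
    (Real.continuous_rpow_const hp).mul hG
  have hmem : C ∈ Set.Icc ((0 : ℝ) ^ p * G 0) ((C + 1) ^ p * G (C + 1)) := by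
    refine ⟨by simp [hG0, hC.le], ?_⟩
    have h1 : 1 ≤ (C + 1) ^ p := Real.one_le_rpow (by linarith) hp
    have h2 := hle (C + 1) (by linarith)
    nlinarith
  obtain ⟨z, hz, hzC⟩ :=
    intermediate_value_Icc (by linarith : (0 : ℝ) ≤ C + 1) hcont.continuousOn hmem
  have hz0 : 0 < z := by
    refine hz.1.lt_of_ne fun h => hC.ne ?_
    subst h
    simpa [hG0] using hzC
  exact ⟨z, ⟨hz0, hzC⟩, fun y hy => hH.injOn hy.1 hz0 (hy.2.trans hzC.symm)⟩

/-- Uniqueness of the Dirichlet root: `f(z) = 1/(z·M(α/2+1,3/2,z²))` is strictly decreasing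
on `(0,∞)`, tends to `+∞` as `z → 0⁺`, to `0` as `z → +∞`, and
`(k·u₀/(γ·2^{β+1}·a^{β+δ+2}))·f(z) = z^{β+δ+1}` has exactly one positive solution. -/
theorem stmt12 (β δ k a γ u₀ : ℝ) (hβ : β ≥ max δ (-1 - δ))
    (hk : 0 < k) (ha : 0 < a) (hγ : 0 < γ) (hu₀ : 0 < u₀)
    (α : ℝ) (hα : α = β - δ)
    (f : ℝ → ℝ) (hf : f = fun z => 1 / (z * kummerM (α/2 + 1) (3/2) (z^2))) :
    StrictAntiOn f (Set.Ioi 0) ∧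
    Filter.Tendsto f (nhdsWithin 0 (Set.Ioi 0)) Filter.atTop ∧
    Filter.Tendsto f Filter.atTop (nhds 0) ∧
    (∃! z : ℝ, 0 < z ∧
      (k * u₀ / (γ * (2:ℝ) ^ (β + 1) * a ^ (β + δ + 2))) * f z = z ^ (β + δ + 1)) := by
  subst hα hf
  have hβ₁ : δ ≤ β := (le_max_left _ _).trans hβ
  have hβ₂ : -1 - δ ≤ β := (le_max_right _ _).trans hβ
  have hA : 0 < (β - δ) / 2 + 1 := by linarith
  have hB : (0 : ℝ) < 3 / 2 := by norm_num
  have hcont := continuous_mul_kummerM_sq hA hB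
  have hmono := strictMonoOn_mul_kummerM_sq hA hB
  have hle := fun z (hz : (0 : ℝ) ≤ z) => le_mul_kummerM_sq hA hB hz
  simp only [one_div]
  refine ⟨?_, ?_, ?_, ?_⟩
  · intro x hx y hy hxy
    have hx : 0 < x := hx
    exact inv_strictAnti₀ (hx.trans_le (hle x hx.le))
      (hmono hx.le (hx.trans hxy).le hxy)
  · refine Filter.Tendsto.inv_tendsto_nhdsGT_zero (tendsto_nhdsWithin_iff.2 ⟨?_, ?_⟩)
    · simpa using (hcont.tendsto 0).mono_left nhdsWithin_le_nhds
    · filter_upwards [self_mem_nhdsWithin] with z hz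
      have hz : 0 < z := hz
      exact hz.trans_le (hle z hz.le)
  · refine Filter.Tendsto.inv_tendsto_atTop (Filter.tendsto_atTop_mono' _ ?_ Filter.tendsto_id)
    filter_upwards [Filter.eventually_ge_atTop 0] with z hz using hle z hz
  · have hC : 0 < k * u₀ / (γ * (2:ℝ) ^ (β + 1) * a ^ (β + δ + 2)) := by positivity
    refine (existsUnique_congr fun z => and_congr_right fun hz => ?_).1
      (existsUnique_rpow_mul_eq hcont hmono (by simp) hle (by linarith : 0 ≤ β + δ + 1) hC)
    rw [← div_eq_mul_inv, div_eq_iff (hz.trans_le (hle z hz.le)).ne', eq_comm]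
end

section
/- (Theorem 3.1, equivalence of problem (P) to the Dirichlet problem — forward direction.) Let β and δ be real constants with β ≥ max(δ, −1−δ), set α = β − δ, and let k, a, h₀, γ, u_∞ > 0 and λ ≥ 0. Let ξ be the unique positive solution of (k·u_∞/(γ·2^{β+1}·a^{β+δ+2}))·f_λ(z) = z^{β+δ+1}, where f_λ(z) = 1/( (k/(2·a·h₀))·M(α/2 + 1/2, 1/2, z²) + λ·z·M(α/2 + 1, 3/2, z²) ). Define u₀ = u_∞·ξ·M(−α/2 + 1/2, 3/2, −ξ²) / ( (k/(2·a·h₀))·M(−α/2, 1/2, −ξ²) + λ·ξ·M(−α/2 + 1/2, 3/2, −ξ²) ). Then u₀ > 0 and the unique positive solution ξ_D of the Dirichlet equation (k·u₀/(γ·2^{β+1}·a^{β+δ+2}))·f(z) = z^{β+δ+1}, with f(z) = 1/(z·M(α/2 + 1, 3/2, z²)), satisfies ξ_D = ξ. -/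
open Finset in
/-- A Chu–Vandermonde identity for rising factorials. -/
theorem sum_antidiagonal_choose_mul_ascPochhammer (a : ℝ) (n : ℕ) (b : ℝ) :
    ∑ ij ∈ antidiagonal n, (n.choose ij.1 : ℝ) *
      ((-1) ^ ij.1 * (ascPochhammer ℝ ij.1).eval a * (ascPochhammer ℝ ij.2).eval (b + ij.1)) =
      (ascPochhammer ℝ n).eval (b - a) := by
  induction n generalizing b with
  | zero => simp
  | succ n ih =>
    have hleft (m : ℕ) (x : ℝ) :
        (ascPochhammer ℝ (m + 1)).eval x = x * (ascPochhammer ℝ m).eval (x + 1) := by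
      simp [ascPochhammer_succ_left]
    rw [Finset.sum_antidiagonal_choose_succ_mul (fun i j => (-1) ^ i *
      (ascPochhammer ℝ i).eval a * (ascPochhammer ℝ j).eval (b + (i : ℝ))) n,
      hleft, show b - a + 1 = b + 1 - a by ring, ← ih (b + 1), Finset.mul_sum,
      ← Finset.sum_add_distrib]
    refine Finset.sum_congr rfl fun ij hij => ?_
    rw [← Nat.choose_symm_of_eq_add (mem_antidiagonal.mp hij).symm, hleft,
      ascPochhammer_succ_eval, Nat.cast_succ,
      show b + ((ij.1 : ℝ) + 1) = b + 1 + ij.1 by ring,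
      show b + (ij.1 : ℝ) + 1 = b + 1 + ij.1 by ring]
    ring

theorem summable_kummerM {a b z : ℝ} (ha : 0 < a) (hb : 0 < b) (hz : 0 < z) :
    Summable fun n : ℕ => ((ascPochhammer ℝ n).eval a / (ascPochhammer ℝ n).eval b) * z ^ n /
      (n.factorial : ℝ) := by
  have hpos (n : ℕ) : 0 < ((ascPochhammer ℝ n).eval a / (ascPochhammer ℝ n).eval b) * z ^ n /
      (n.factorial : ℝ) := by
    have := ascPochhammer_pos n a ha
    have := ascPochhammer_pos n b hb
    positivity
  obtain ⟨N, hN⟩ := exists_nat_gt (2 * z * (a / b + 1))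
  refine summable_of_ratio_norm_eventually_le (r := 1 / 2) (by norm_num) ?_
  filter_upwards [Filter.eventually_ge_atTop N] with n hn
  rw [Real.norm_of_nonneg (hpos _).le, Real.norm_of_nonneg (hpos _).le]
  have hb' := ascPochhammer_pos n b hb
  have hn' : (N : ℝ) ≤ n := by exact_mod_cast hn
  have hn0 : (0 : ℝ) ≤ n := n.cast_nonneg
  have hratio : ((ascPochhammer ℝ (n + 1)).eval a / (ascPochhammer ℝ (n + 1)).eval b) *
      z ^ (n + 1) / ((n + 1).factorial : ℝ) = ((a + n) / (b + n) * z / (n + 1)) *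
      (((ascPochhammer ℝ n).eval a / (ascPochhammer ℝ n).eval b) * z ^ n / (n.factorial : ℝ)) := by
    rw [ascPochhammer_succ_eval, ascPochhammer_succ_eval, Nat.factorial_succ]
    push_cast
    have : b + n ≠ 0 := by positivity
    field_simp
    ring
  rw [hratio]
  refine mul_le_mul_of_nonneg_right ?_ (hpos n).le
  have hquot : (a + n) / (b + n) ≤ a / b + 1 := by
    rw [div_le_iff₀ (by positivity)]
    have : (a / b + 1) * (b + n) = a + n + (b + a / b * n) := by field_simp; ring
    rw [this]
    have : 0 ≤ b + a / b * n := by positivity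
    linarith
  rw [div_le_iff₀ (by positivity)]
  have := mul_le_mul_of_nonneg_right hquot hz.le
  linarith

/-- Kummer's transformation. -/
theorem kummerM_neg_eq_exp_mul {a b z : ℝ} (ha : 0 < a) (hb : 0 < b) (hz : 0 < z) :
    kummerM (b - a) b (-z) = Real.exp (-z) * kummerM a b z := by
  have hexp : Summable fun n : ℕ => ‖(-z) ^ n / (n.factorial : ℝ)‖ :=
    (Real.summable_pow_div_factorial (-z)).norm
  rw [mul_comm, Real.exp_eq_exp_ℝ, NormedSpace.exp_eq_tsum_div, kummerM, kummerM,
    tsum_mul_tsum_eq_tsum_sum_antidiagonal_of_summable_norm (summable_kummerM ha hb hz).norm hexp]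
  refine tsum_congr fun n => ?_
  rw [← sum_antidiagonal_choose_mul_ascPochhammer a n b, Finset.sum_div, Finset.sum_mul,
    Finset.sum_div]
  refine Finset.sum_congr rfl fun ij hij => ?_
  obtain ⟨i, j⟩ := ij
  obtain rfl : i + j = n := Finset.HasAntidiagonal.mem_antidiagonal.mp hij
  have hi := ascPochhammer_pos i b hb
  have hj := ascPochhammer_pos j (b + i) (by positivity)
  have hsplit : (ascPochhammer ℝ (i + j)).eval b =
      (ascPochhammer ℝ i).eval b * (ascPochhammer ℝ j).eval (b + i) := by
    simp [← ascPochhammer_mul]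
  have hsign : ((-1 : ℝ) ^ i) ^ 2 = 1 := by rw [← pow_mul, mul_comm, pow_mul]; simp
  rw [hsplit, Nat.cast_add_choose, neg_pow z (i + j), neg_pow z j, pow_add, pow_add]
  have := Nat.factorial_ne_zero (i + j)
  field_simp
  linear_combination (ascPochhammer ℝ i).eval a * hsign

theorem kummerM_pos {a b z : ℝ} (ha : 0 < a) (hb : 0 < b) (hz : 0 < z) : 0 < kummerM a b z := by
  refine (summable_kummerM ha hb hz).tsum_pos (fun n => ?_) 0 (by simp)
  have := ascPochhammer_pos n a ha
  have := ascPochhammer_pos n b hb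
  positivity

theorem kummerM_le_kummerM {a b z w : ℝ} (ha : 0 < a) (hb : 0 < b) (hz : 0 < z) (hzw : z ≤ w) :
    kummerM a b z ≤ kummerM a b w := by
  refine (summable_kummerM ha hb hz).tsum_le_tsum (fun n => ?_)
    (summable_kummerM ha hb (hz.trans_le hzw))
  have := ascPochhammer_pos n a ha
  have := ascPochhammer_pos n b hb
  gcongr

/-- For `c, a, b > 0` and `p ≥ 0`, the equation `c / (z M(a, b, z²)) = z ^ p` has at most one
positive root. -/
theorem dirichlet_root_unique {c a b p z w : ℝ} (hc : 0 < c) (ha : 0 < a) (hb : 0 < b)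
    (hp : 0 ≤ p) (hz : 0 < z) (hw : 0 < w)
    (hz' : c * (1 / (z * kummerM a b (z ^ 2))) = z ^ p)
    (hw' : c * (1 / (w * kummerM a b (w ^ 2))) = w ^ p) : z = w := by
  have key {x y : ℝ} (hx : 0 < x) (hxy : x < y) :
      c * (1 / (y * kummerM a b (y ^ 2))) < c * (1 / (x * kummerM a b (x ^ 2))) := by
    have hM := kummerM_pos ha hb (pow_pos hx 2)
    have hle : kummerM a b (x ^ 2) ≤ kummerM a b (y ^ 2) :=
      kummerM_le_kummerM ha hb (pow_pos hx 2) (by gcongr)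
    exact mul_lt_mul_of_pos_left (one_div_lt_one_div_of_lt (by positivity)
      (mul_lt_mul hxy hle hM (hx.trans hxy).le)) hc
  rcases lt_trichotomy z w with h | h | h
  · have := key hz h
    have := Real.rpow_le_rpow hz.le h.le hp
    linarith
  · exact h
  · have := key hw h
    have := Real.rpow_le_rpow hw.le h.le hp
    linarith

/-- Theorem 3.1 (forward direction): if `ξ` is the positive root of the equation for
problem (P) and `u₀` is defined from `λ, u_∞, h₀` by the equivalence formula, then
`u₀ > 0` and `ξ` is the unique positive root of the Dirichlet equation
`(k·u₀/(γ·2^{β+1}·a^{β+δ+2}))·f(z) = z^{β+δ+1}` with `f(z) = 1/(z·M(α/2+1,3/2,z²))`,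
i.e. `ξ_D = ξ`. -/
theorem stmt13 (β δ k a h₀ γ uinf lam : ℝ) (hβ : β ≥ max δ (-1 - δ))
    (hk : 0 < k) (ha : 0 < a) (hh : 0 < h₀) (hγ : 0 < γ) (huinf : 0 < uinf)
    (hlam : 0 ≤ lam) (α : ℝ) (hα : α = β - δ)
    (ξ : ℝ) (hξpos : 0 < ξ)
    (hξ : (k * uinf / (γ * (2:ℝ) ^ (β + 1) * a ^ (β + δ + 2))) *
      (1 / ((k / (2 * a * h₀)) * kummerM (α/2 + 1/2) (1/2) (ξ^2) +
        lam * ξ * kummerM (α/2 + 1) (3/2) (ξ^2))) = ξ ^ (β + δ + 1))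
    (u₀ : ℝ)
    (hu₀ : u₀ = uinf * ξ * kummerM (-α/2 + 1/2) (3/2) (-ξ^2) /
      ((k / (2 * a * h₀)) * kummerM (-α/2) (1/2) (-ξ^2) +
        lam * ξ * kummerM (-α/2 + 1/2) (3/2) (-ξ^2))) :
    0 < u₀ ∧
    ((k * u₀ / (γ * (2:ℝ) ^ (β + 1) * a ^ (β + δ + 2))) *
      (1 / (ξ * kummerM (α/2 + 1) (3/2) (ξ^2))) = ξ ^ (β + δ + 1)) ∧
    (∀ z : ℝ, 0 < z →
      (k * u₀ / (γ * (2:ℝ) ^ (β + 1) * a ^ (β + δ + 2))) *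
        (1 / (z * kummerM (α/2 + 1) (3/2) (z^2))) = z ^ (β + δ + 1) → z = ξ) := by
  have hβδ : δ ≤ β := (le_max_left _ _).trans hβ
  have hp : 0 ≤ β + δ + 1 := by
    have := (le_max_right _ _).trans hβ
    linarith
  have hα0 : 0 ≤ α := by linarith
  have hsq : 0 < ξ ^ 2 := by positivity
  have hP := kummerM_pos (a := α / 2 + 1) (b := 3 / 2) (by linarith) (by norm_num) hsq
  have hQ := kummerM_pos (a := α / 2 + 1 / 2) (b := 1 / 2) (by linarith) (by norm_num) hsq
  have hKP := kummerM_neg_eq_exp_mul (a := α / 2 + 1) (b := 3 / 2) (by linarith) (by norm_num) hsq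
  have hKQ :=
    kummerM_neg_eq_exp_mul (a := α / 2 + 1 / 2) (b := 1 / 2) (by linarith) (by norm_num) hsq
  rw [show (3 / 2 : ℝ) - (α / 2 + 1) = -α / 2 + 1 / 2 by ring] at hKP
  rw [show (1 / 2 : ℝ) - (α / 2 + 1 / 2) = -α / 2 by ring] at hKQ
  rw [hKP, hKQ] at hu₀
  set P := kummerM (α / 2 + 1) (3 / 2) (ξ ^ 2)
  set Q := kummerM (α / 2 + 1 / 2) (1 / 2) (ξ ^ 2)
  have hE := Real.exp_pos (-ξ ^ 2)
  set E := Real.exp (-ξ ^ 2)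
  have hD : 0 < k / (2 * a * h₀) * Q + lam * ξ * P := by positivity
  have hu : u₀ = uinf * ξ * P / (k / (2 * a * h₀) * Q + lam * ξ * P) := by
    rw [hu₀, show uinf * ξ * (E * P) = E * (uinf * ξ * P) by ring,
      show k / (2 * a * h₀) * (E * Q) + lam * ξ * (E * P) =
        E * (k / (2 * a * h₀) * Q + lam * ξ * P) by ring, mul_div_mul_left _ _ hE.ne']
  have hupos : 0 < u₀ := by rw [hu]; positivity
  have hroot : (k * u₀ / (γ * (2:ℝ) ^ (β + 1) * a ^ (β + δ + 2))) * (1 / (ξ * P)) =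
      ξ ^ (β + δ + 1) := by
    rw [← hξ, hu]
    generalize k / (2 * a * h₀) * Q + lam * ξ * P = D at hD
    field_simp
  exact ⟨hupos, hroot, fun z hz hzroot =>
    dirichlet_root_unique (by positivity) (by linarith) (by norm_num) hp hz hξpos hzroot hroot⟩
end
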